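/- Let G be a group with a finite symmetric generating set S whose growth function satisfies γ_S(n) ≤ C·n^k for all n ≥ 1, for some constant C > 0 and k ∈ ℕ. Define the derived series by G^(0) = G and G^(i+1) = [G^(i), G^(i)]. Suppose that for every i ≥ 1 such that G^(i) is nontrivial there exists a nontrivial group homomorphism from G^(i) to the additive group ℝ^l. Then G^(k+1) is the trivial subgroup; in particular, G is solvable. -/

import Mathlib

open scoped BigOperators

/-- The ball of radius `n` in a group `G` with respect to a set `S`:
elements expressible as a product of at most `n` elements of `S`. -/
def ball {G : Type*} [Group G] (S : Set G) (n : ℕ) : Set G :=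
  {g | ∃ l : List G, (∀ x ∈ l, x ∈ S) ∧ l.length ≤ n ∧ l.prod = g}

/-- The growth function of `G` relative to `S`: `γ_S(n) = |B_S(n)|`. -/
noncomputable def growth {G : Type*} [Group G] (S : Set G) (n : ℕ) : ℕ := (ball S n).ncard

/-- A finite symmetric generating set of `G`. -/
def IsSymmGen {G : Type*} [Group G] (S : Finset G) : Prop :=
  (∀ x ∈ S, x⁻¹ ∈ S) ∧ Subgroup.closure (S : Set G) = ⊤

/-- `G` has polynomial growth: for some finite symmetric generating set `S`
there are `C > 0` and `k : ℕ` with `γ_S(n) ≤ C * n ^ k` for all `n ≥ 1`. -/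
def HasPolyGrowth (G : Type*) [Group G] : Prop :=
  ∃ S : Finset G, IsSymmGen S ∧ ∃ C : ℝ, 0 < C ∧ ∃ k : ℕ,
    ∀ n : ℕ, 1 ≤ n → (growth (S : Set G) n : ℝ) ≤ C * (n : ℝ) ^ k

theorem ball_mono {G : Type*} [Group G] (S : Set G) {m n : ℕ} (h : m ≤ n) :
    ball S m ⊆ ball S n := by
  rintro g ⟨w, hw, hlen, rfl⟩
  exact ⟨w, hw, hlen.trans h, rfl⟩

theorem mul_mem_ball {G : Type*} [Group G] {S : Set G} {m n : ℕ} {g h : G}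
    (hg : g ∈ ball S m) (hh : h ∈ ball S n) : g * h ∈ ball S (m + n) := by
  obtain ⟨v, hv, hvlen, rfl⟩ := hg
  obtain ⟨w, hw, hwlen, rfl⟩ := hh
  refine ⟨v ++ w, fun x hx => ?_, ?_, List.prod_append⟩
  · exact (List.mem_append.1 hx).elim (hv x) (hw x)
  · rw [List.length_append]
    exact Nat.add_le_add hvlen hwlen

theorem one_mem_ball {G : Type*} [Group G] (S : Set G) (n : ℕ) : (1 : G) ∈ ball S n :=
  ⟨[], by simp, by simp, rfl⟩

theorem pow_mem_ball_mul {G : Type*} [Group G] {S : Set G} {m : ℕ} {g : G}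
    (hg : g ∈ ball S m) (a : ℕ) : g ^ a ∈ ball S (m * a) := by
  induction a with
  | zero => simpa using one_mem_ball S 0
  | succ a ih =>
    rw [pow_succ, Nat.mul_succ]
    exact mul_mem_ball ih hg

theorem finite_ball {G : Type*} [Group G] {S : Set G} (hS : S.Finite) (n : ℕ) :
    (ball S n).Finite := by
  have : Finite S := hS
  refine ((List.finite_length_le S n).image fun w => (w.map Subtype.val).prod).subset ?_
  rintro g ⟨w, hw, hlen, rfl⟩
  lift w to List S using hw
  exact ⟨w, by simpa using hlen, rfl⟩

theorem IsSymmGen.exists_mem_ball {G : Type*} [Group G] {S : Finset G} (hS : IsSymmGen S)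
    (g : G) : ∃ m, g ∈ ball (S : Set G) m := by
  have hg : g ∈ (Subgroup.closure (S : Set G)).toSubmonoid := hS.2 ▸ Subgroup.mem_top g
  rw [Subgroup.closure_toSubmonoid] at hg
  obtain ⟨w, hw, rfl⟩ := Submonoid.exists_list_of_mem_closure hg
  refine ⟨w.length, w, fun x hx => ?_, le_rfl, rfl⟩
  rcases hw x hx with h | h
  · exact h
  · simpa using hS.1 _ h

open scoped commutatorElement in
/-- A homomorphism from a subgroup to a commutative group vanishes on the commutator subgroup. -/
theorem map_eq_one_of_mem_commutator {G A : Type*} [Group G] [CommGroup A] {H : Subgroup G}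
    (f : H →* A) (x : H) (hx : (x : G) ∈ ⁅H, H⁆) : f x = 1 := by
  have hle : ⁅H, H⁆ ≤ f.ker.map H.subtype := by
    rw [Subgroup.commutator_le]
    intro a ha b hb
    refine ⟨⁅(⟨a, ha⟩ : H), ⟨b, hb⟩⁆, ?_, rfl⟩
    exact (map_commutatorElement f _ _).trans
      (commutatorElement_eq_one_iff_mul_comm.2 (mul_comm _ _))
  obtain ⟨y, hy, hyx⟩ := hle hx
  rw [← Subtype.ext (show (y : G) = x from hyx)]
  exact hy

/-- If `d` consecutive terms of the derived series, starting from the `i`-th, have nonzero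
additive maps to torsion-free groups, then the `i`-th term meets balls of radius `c * n` in at
least `(n + 1) ^ d` points. -/
theorem exists_finset_derivedSeries_card_eq {G V : Type*} [Group G] [AddCommGroup V]
    [IsAddTorsionFree V] {S : Finset G} (hS : IsSymmGen S) (d i : ℕ)
    (hhom : ∀ j, i ≤ j → j < i + d → ∃ f : derivedSeries G j → V,
      (∀ x y, f (x * y) = f x + f y) ∧ ∃ x, f x ≠ 0) :
    ∃ c : ℕ, ∀ n : ℕ, ∃ T : Finset G, T.card = (n + 1) ^ d ∧
      ∀ t ∈ T, t ∈ derivedSeries G i ∧ t ∈ ball (S : Set G) (c * n) := by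
  classical
  induction d generalizing i with
  | zero =>
    refine ⟨0, fun n => ⟨{1}, by simp, fun t ht => ?_⟩⟩
    rw [Finset.mem_singleton.1 ht]
    exact ⟨one_mem _, one_mem_ball _ _⟩
  | succ d ih =>
    obtain ⟨c, hc⟩ := ih (i + 1) fun j hj hj' => hhom j (by omega) (by omega)
    obtain ⟨f, hf, g, hg⟩ := hhom i le_rfl (by omega)
    let F : derivedSeries G i →* Multiplicative V :=
      MonoidHom.mk' (fun x => Multiplicative.ofAdd (f x)) fun x y => by rw [hf, ofAdd_add]
    obtain ⟨m, hm⟩ := hS.exists_mem_ball (g : G)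
    have hle : derivedSeries G (i + 1) ≤ derivedSeries G i :=
      derivedSeries_antitone G i.le_succ
    refine ⟨m + c, fun n => ?_⟩
    obtain ⟨T, hcard, hT⟩ := hc n
    refine ⟨(Finset.range (n + 1) ×ˢ T).image fun p => (g : G) ^ p.1 * p.2, ?_, ?_⟩
    · rw [Finset.card_image_of_injOn, Finset.card_product, Finset.card_range, hcard, pow_succ']
      have key : ∀ (a : ℕ) (t : derivedSeries G i), (t : G) ∈ derivedSeries G (i + 1) →
          F (g ^ a * t) = Multiplicative.ofAdd (a • f g) := fun a t ht => by
        rw [map_mul, map_eq_one_of_mem_commutator F t ht, mul_one, map_pow]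
        rfl
      rintro ⟨a, s⟩ hs ⟨b, t⟩ ht hst
      have hs' := (hT s (Finset.mem_product.1 hs).2).1
      have ht' := (hT t (Finset.mem_product.1 ht).2).1
      have heq : g ^ a * ⟨s, hle hs'⟩ = g ^ b * ⟨t, hle ht'⟩ := Subtype.ext hst
      have hF := congrArg F heq
      rw [key a _ hs', key b _ ht'] at hF
      obtain rfl : a = b := injective_nsmul_iff_not_isOfFinAddOrder.2
        (not_isOfFinAddOrder_of_isAddTorsionFree hg) (Multiplicative.ofAdd.injective hF)
      exact congrArg (Prod.mk a) (mul_left_cancel hst)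
    · simp only [Finset.mem_image, Finset.mem_product, Finset.mem_range]
      rintro _ ⟨⟨a, t⟩, ⟨ha, ht⟩, rfl⟩
      obtain ⟨htD, htB⟩ := hT t ht
      refine ⟨mul_mem (pow_mem g.2 a) (hle htD), ?_⟩
      rw [add_mul]
      exact mul_mem_ball
        (ball_mono _ (Nat.mul_le_mul_left m (Nat.lt_succ_iff.1 ha)) (pow_mem_ball_mul hm a)) htB

/-- If `G` has growth function bounded by `C * n ^ k` and every nontrivial term
of the derived series of index at least one admits a nontrivial homomorphism to `ℝ^l`,
then the `(k+1)`-st derived subgroup is trivial; in particular `G` is solvable. -/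
theorem stmt2 {G : Type*} [Group G] (S : Finset G) (hS : IsSymmGen S)
    (C : ℝ) (hC : 0 < C) (k l : ℕ)
    (hgrowth : ∀ n : ℕ, 1 ≤ n → (growth (S : Set G) n : ℝ) ≤ C * (n : ℝ) ^ k)
    (hhom : ∀ i : ℕ, 1 ≤ i → derivedSeries G i ≠ ⊥ →
      ∃ f : (derivedSeries G i) → (Fin l → ℝ),
        (∀ x y, f (x * y) = f x + f y) ∧ ∃ x, f x ≠ 0) :
    derivedSeries G (k + 1) = ⊥ ∧ IsSolvable G := by
  suffices h : derivedSeries G (k + 1) = ⊥ from ⟨h, ⟨⟨k + 1, h⟩⟩⟩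
  by_contra hne
  obtain ⟨c, hc⟩ := exists_finset_derivedSeries_card_eq (V := Fin l → ℝ) hS (k + 1) 1
    fun j hj hj' => hhom j hj fun h =>
      hne (le_bot_iff.1 (h ▸ derivedSeries_antitone G (by omega : j ≤ k + 1)))
  obtain ⟨n, hn⟩ := exists_nat_gt (C * ((c + 1 : ℕ) : ℝ) ^ k)
  have hn0 : (0 : ℝ) < n := lt_of_le_of_lt (by positivity) hn
  have hn1 : 1 ≤ n := by exact_mod_cast hn0
  obtain ⟨T, hcard, hT⟩ := hc n
  have hlow : (n + 1) ^ (k + 1) ≤ growth (S : Set G) ((c + 1) * n) := by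
    rw [← hcard, ← Set.ncard_coe_finset]
    exact Set.ncard_le_ncard
      (fun t ht => ball_mono _ (Nat.mul_le_mul_right n c.le_succ) (hT t ht).2)
      (finite_ball S.finite_toSet _)
  have hup := hgrowth ((c + 1) * n) (Nat.mul_pos c.succ_pos hn1)
  have hlow' : ((n : ℝ) + 1) ^ (k + 1) ≤ growth (S : Set G) ((c + 1) * n) := by
    exact_mod_cast hlow
  have hpow : (n : ℝ) ^ (k + 1) ≤ ((n : ℝ) + 1) ^ (k + 1) := by gcongr; linarith
  have hlt := mul_lt_mul_of_pos_right hn (pow_pos hn0 k)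
  rw [Nat.cast_mul, mul_pow, ← mul_assoc] at hup
  rw [pow_succ'] at hpow
  linarith
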